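/- (Key lemma, non-strict version) Let M = (Q, E, δ) be an MDP with priority function p : Q → ℕ and weight function w : Q × Q → ℤ such that the whole state space Q is an end-component of M and the minimum of p over Q is even. If there exists a state q ∈ Q with ValMP(w)(q) ≥ ν for a threshold ν ∈ ℝ, then there exists a strategy σ* such that for every state q ∈ Q, P_q^{σ*}(Parity(p) ∩ MeanPayoff^{≥ν}) = 1. -/

import Mathlib

open MeasureTheory Filter
open scoped Classical ENNReal

namespace MPP

/-- A Markov decision process: states `Q`, player-1 states `Q1` (the rest are
probabilistic), edge relation `E` with every state having a successor, and a
probabilistic transition function `δ` whose support at every probabilistic state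
is exactly the set of successors. -/
structure MDP (Q : Type) where
  Q1 : Set Q
  E : Q → Q → Prop
  E_nonempty : ∀ q, ∃ q', E q q'
  δ : Q → PMF Q
  δ_support : ∀ q, q ∉ Q1 → ∀ q', q' ∈ (δ q).support ↔ E q q'

/-- A strategy: given the history `h` (the states strictly before the current one)
and the current state `q`, if `q` is a player-1 state it selects a distribution on
successors of `q`. -/
structure Strategy {Q : Type} (M : MDP Q) where
  act : List Q → Q → PMF Q
  act_support : ∀ h q, q ∈ M.Q1 → ∀ q', q' ∈ (act h q).support → M.E q q'

variable {Q : Type}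

/-- One step of the history-dependent transition kernel. -/
noncomputable def MDP.step (M : MDP Q) (σ : Strategy M) (h : List Q) (q : Q) : PMF Q :=
  if q ∈ M.Q1 then σ.act h q else M.δ q

/-- Probability of traversing the finite sequence `future` starting at `q` with
past history `h`. -/
noncomputable def pathProb (M : MDP Q) (σ : Strategy M) : List Q → Q → List Q → ℝ≥0∞
  | _, _, [] => 1
  | h, q, q' :: rest => M.step σ h q q' * pathProb M σ (h ++ [q]) q' rest

/-- `μ` is the trajectory measure (Ionescu–Tulcea) on plays of `M` under strategy
`σ`, starting at `q`: it is the (unique) probability measure on `ℕ → Q` (product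
σ-algebra) giving every cylinder its product probability. -/
def IsTrajMeasure [MeasurableSpace Q] (M : MDP Q) (σ : Strategy M) (q : Q)
    (μ : Measure (ℕ → Q)) : Prop :=
  IsProbabilityMeasure μ ∧
    ∀ (n : ℕ) (f : ℕ → Q),
      μ {ρ | ∀ i ≤ n, ρ i = f i} =
        if f 0 = q then pathProb M σ [] q ((List.range n).map fun i => f (i + 1)) else 0

/-- The set of states occurring infinitely often in a play. -/
def infSet (ρ : ℕ → Q) : Set Q := {s | ∀ N, ∃ n, N ≤ n ∧ ρ n = s}

/-- End-component: nonempty, closed under probabilistic transitions, every state has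
a successor inside, and strongly connected inside. -/
def MDP.IsEndComponent (M : MDP Q) (U : Set Q) : Prop :=
  U.Nonempty ∧
    (∀ q ∈ U, q ∉ M.Q1 → (M.δ q).support ⊆ U) ∧
    (∀ q ∈ U, ∃ q' ∈ U, M.E q q') ∧
    ∀ q ∈ U, ∀ q' ∈ U, Relation.ReflTransGen (fun a b => a ∈ U ∧ b ∈ U ∧ M.E a b) q q'

/-- Energy level of the length-`n` prefix of a play. -/
def EL (w : Q → Q → ℤ) (ρ : ℕ → Q) (n : ℕ) : ℤ :=
  ∑ i ∈ Finset.range n, w (ρ i) (ρ (i + 1))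

/-- Mean payoff (liminf of averages) of a play. -/
noncomputable def MP (w : Q → Q → ℤ) (ρ : ℕ → Q) : ℝ :=
  liminf (fun n => (EL w ρ n : ℝ) / n) atTop

/-- Parity objective: the minimal priority visited infinitely often is even. -/
def ParitySet (p : Q → ℕ) : Set (ℕ → Q) := {ρ | Even (sInf (p '' infSet ρ))}

def MeanPayoffGe (w : Q → Q → ℤ) (ν : ℝ) : Set (ℕ → Q) := {ρ | ν ≤ MP w ρ}

def MeanPayoffGt (w : Q → Q → ℤ) (ν : ℝ) : Set (ℕ → Q) := {ρ | ν < MP w ρ}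

/-- Energy objective with initial credit `c₀`. -/
def PosEnergy (w : Q → Q → ℤ) (c₀ : ℕ) : Set (ℕ → Q) :=
  {ρ | ∀ n, 0 ≤ (c₀ : ℤ) + EL w ρ n}

/-- Büchi objective: some state of `B` is visited infinitely often. -/
def Buchi (B : Set Q) : Set (ℕ → Q) := {ρ | (infSet ρ ∩ B).Nonempty}

/-- Expected mean-payoff value: supremum over strategies of the expectation of the
mean payoff under the trajectory measure. -/
noncomputable def ValMP [MeasurableSpace Q] (M : MDP Q) (w : Q → Q → ℤ) (q : Q) : ℝ :=
  sSup {x | ∃ σ : Strategy M, ∃ μ : Measure (ℕ → Q),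
    IsTrajMeasure M σ q μ ∧ x = ∫ ρ, MP w ρ ∂μ}



section ACOE

variable [Fintype Q] (M : MDP Q)

/-- successors as a finset -/
noncomputable def succs (q : Q) : Finset Q := Finset.univ.filter (fun q' => M.E q q')

lemma succs_ne (q : Q) : (succs M q).Nonempty := by
  obtain ⟨q', h⟩ := M.E_nonempty q
  exact ⟨q', by simp [succs, h]⟩

/-- Bellman operator -/
noncomputable def Bell (w : Q → Q → ℤ) (l : ℝ) (V : Q → ℝ) (q : Q) : ℝ :=
  if q ∈ M.Q1 then (succs M q).sup' (succs_ne M q) (fun q' => (w q q' : ℝ) + l * V q')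
  else ∑ q', (M.δ q q').toReal * ((w q q' : ℝ) + l * V q')

lemma pmf_sum (P : PMF Q) : ∑ q', (P q').toReal = 1 := by
  have h := P.tsum_coe
  rw [tsum_fintype] at h
  rw [← ENNReal.toReal_sum (fun a _ => P.apply_ne_top a), h]
  simp

lemma Bell_le (w : Q → Q → ℤ) (l : ℝ) (hl : 0 ≤ l) (V V' : Q → ℝ) (c : ℝ)
    (h : ∀ q, V q ≤ V' q + c) (q : Q) : Bell M w l V q ≤ Bell M w l V' q + l * c := by
  have key : ∀ q', (w q q' : ℝ) + l * V q' ≤ (w q q' : ℝ) + l * V' q' + l * c := by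
    intro q'
    nlinarith [mul_le_mul_of_nonneg_left (h q') hl]
  unfold Bell
  split_ifs with hq
  · apply Finset.sup'_le
    intro b hb
    refine (key b).trans ?_
    gcongr
    exact Finset.le_sup' (fun q' => (w q q' : ℝ) + l * V' q') hb
  · calc _ ≤ ∑ q', (M.δ q q').toReal * ((w q q' : ℝ) + l * V' q' + l * c) := by
          exact Finset.sum_le_sum fun q' _ => mul_le_mul_of_nonneg_left (key q') ENNReal.toReal_nonneg
      _ = _ := by
          simp_rw [mul_add _ _ (l * c)]
          rw [Finset.sum_add_distrib, ← Finset.sum_mul, pmf_sum, one_mul]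

lemma Bell_fix (w : Q → Q → ℤ) (l : ℝ) (hl : 0 ≤ l) (hl1 : l < 1) :
    ∃ V : Q → ℝ, Bell M w l V = V := by
  have hc : ContractingWith (⟨l, hl⟩ : NNReal) (Bell M w l) := by
    refine ⟨by exact_mod_cast hl1, ?_⟩
    apply LipschitzWith.of_dist_le_mul
    intro x y
    rw [dist_pi_le_iff (by positivity)]
    intro q
    have h1 := Bell_le M w l hl x y (dist x y) (fun q => by
      have := dist_le_pi_dist x y q
      rw [Real.dist_eq] at this
      linarith [le_abs_self (x q - y q)]) q
    have h2 := Bell_le M w l hl y x (dist x y) (fun q => by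
      have := dist_le_pi_dist x y q
      rw [Real.dist_eq] at this
      linarith [neg_abs_le (x q - y q)]) q
    rw [Real.dist_eq, abs_le]
    change -(l * dist x y) ≤ _ ∧ _ ≤ l * dist x y
    constructor <;> linarith
  exact ⟨_, hc.fixedPoint_isFixedPt⟩

lemma exists_wbound (w : Q → Q → ℤ) : ∃ W : ℝ, 0 ≤ W ∧ ∀ q q', |(w q q' : ℝ)| ≤ W := by
  refine ⟨∑ q, ∑ q', |(w q q' : ℝ)|, by positivity, fun q q' => ?_⟩
  refine le_trans ?_ (Finset.single_le_sum (f := fun q => ∑ q', |(w q q' : ℝ)|)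
    (fun i _ => by positivity) (Finset.mem_univ q))
  exact Finset.single_le_sum (f := fun q' => |(w q q' : ℝ)|)
    (fun i _ => by positivity) (Finset.mem_univ q')

lemma exists_cmin : ∃ c : ℝ, 0 < c ∧ c ≤ 1 ∧
    ∀ q, q ∉ M.Q1 → ∀ q', M.E q q' → c ≤ (M.δ q q').toReal := by
  have hpos : ∀ q, q ∉ M.Q1 → ∀ q', M.E q q' → 0 < (M.δ q q').toReal := by
    intro q hq q' h
    have := (M.δ_support q hq q').2 h
    rw [PMF.mem_support_iff] at this
    exact ENNReal.toReal_pos this ((M.δ q).apply_ne_top q')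
  let f : Q × Q → ℝ := fun x => if 0 < (M.δ x.1 x.2).toReal then (M.δ x.1 x.2).toReal else 1
  have hf : ∀ x, 0 < f x := by
    intro x
    simp only [f]
    split_ifs with h
    · exact h
    · norm_num
  rcases isEmpty_or_nonempty Q with hQ | hQ
  · exact ⟨1, one_pos, le_rfl, fun q => (hQ.false q).elim⟩
  obtain ⟨x, hx⟩ := Finite.exists_min f
  refine ⟨min (f x) 1, lt_min (hf x) one_pos, min_le_right _ _, fun q hq q' h => ?_⟩
  refine (min_le_left _ _).trans ((hx (q, q')).trans ?_)
  simp only [f]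
  rw [if_pos (hpos q hq q' h)]

/-- Bounds on the discounted value. -/
lemma Bell_fix_abs (w : Q → Q → ℤ) (W : ℝ) (hW : ∀ q q', |(w q q' : ℝ)| ≤ W)
    (l : ℝ) (hl : 0 ≤ l) (hl1 : l < 1) (V : Q → ℝ) (hV : Bell M w l V = V) (q : Q) :
    |(1 - l) * V q| ≤ W := by
  have hQ : Nonempty Q := ⟨q⟩
  have hub : ∀ B, (∀ q, V q ≤ B) → ∀ q, V q ≤ W + l * B := by
    intro B hB q
    rw [← congrFun hV q]
    have key : ∀ q', (w q q' : ℝ) + l * V q' ≤ W + l * B := fun q' =>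
      add_le_add ((le_abs_self _).trans (hW q q')) (mul_le_mul_of_nonneg_left (hB q') hl)
    unfold Bell
    split_ifs
    · exact Finset.sup'_le _ _ (fun b _ => key b)
    · calc _ ≤ ∑ q', (M.δ q q').toReal * (W + l * B) := by
            exact Finset.sum_le_sum fun q' _ => mul_le_mul_of_nonneg_left (key q') ENNReal.toReal_nonneg
        _ = _ := by rw [← Finset.sum_mul, pmf_sum, one_mul]
  have hlb : ∀ B, (∀ q, B ≤ V q) → ∀ q, -W + l * B ≤ V q := by
    intro B hB q
    rw [← congrFun hV q]
    have key : ∀ q', -W + l * B ≤ (w q q' : ℝ) + l * V q' := fun q' =>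
      add_le_add ((abs_le.1 (hW q q')).1) (mul_le_mul_of_nonneg_left (hB q') hl)
    unfold Bell
    split_ifs
    · obtain ⟨b, hb⟩ := succs_ne M q
      exact (key b).trans (Finset.le_sup' (fun q' => (w q q' : ℝ) + l * V q') hb)
    · calc _ ≥ ∑ q', (M.δ q q').toReal * (-W + l * B) := by
            exact Finset.sum_le_sum fun q' _ => mul_le_mul_of_nonneg_left (key q') ENNReal.toReal_nonneg
        _ = _ := by rw [← Finset.sum_mul, pmf_sum, one_mul]
  obtain ⟨a, ha⟩ := Finite.exists_max V
  obtain ⟨b, hb⟩ := Finite.exists_min V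
  have h1 := hub _ ha a
  have h2 := hlb _ hb b
  have h3 := mul_le_mul_of_nonneg_left (ha q) (sub_nonneg.2 hl1.le)
  have h4 := mul_le_mul_of_nonneg_left (hb q) (sub_nonneg.2 hl1.le)
  rw [abs_le]
  constructor <;> nlinarith

/-- one edge -/
lemma edge_bound (w : Q → Q → ℤ) (W : ℝ) (hW : ∀ q q', |(w q q' : ℝ)| ≤ W) (c : ℝ)
    (hc0 : 0 < c) (hc1 : c ≤ 1)
    (hc : ∀ q, q ∉ M.Q1 → ∀ q', M.E q q' → c ≤ (M.δ q q').toReal)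
    (l : ℝ) (hl : 1 / 2 ≤ l) (hl1 : l < 1) (V : Q → ℝ) (hV : Bell M w l V = V)
    (m : Q) (hm : ∀ q, V m ≤ V q) (q q' : Q) (hE : M.E q q') :
    V q' - V m ≤ (2 / c) * (V q - V m + 2 * W) := by
  have hm' := Bell_fix_abs M w W hW l (by linarith) hl1 V hV m
  rw [abs_le] at hm'
  have hu : 0 ≤ V q' - V m := sub_nonneg.2 (hm q')
  have key : -W + l * (V m + c * (V q' - V m)) ≤ V q := by
    rw [← congrFun hV q]
    unfold Bell
    split_ifs with hq
    · have h1 := Finset.le_sup' (s := succs M q) (fun q' => (w q q' : ℝ) + l * V q')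
        (b := q') (by simp [succs, hE])
      refine le_trans ?_ h1
      have h2 := (abs_le.1 (hW q q')).1
      have h3 : V m + c * (V q' - V m) ≤ V q' := by nlinarith
      have := mul_le_mul_of_nonneg_left h3 (show (0:ℝ) ≤ l by linarith)
      linarith
    · have h1 : ∑ x, (M.δ q x).toReal * (-W + l * (V m + if x = q' then V q' - V m else 0))
          ≤ ∑ x, (M.δ q x).toReal * ((w q x : ℝ) + l * V x) := by
        gcongr with x _
        · exact (abs_le.1 (hW q x)).1
        · split_ifs with hx
          · subst hx; linarith
          · linarith [hm x]
      refine le_trans ?_ h1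
      have h2 : ∑ x, (M.δ q x).toReal * (-W + l * (V m + if x = q' then V q' - V m else 0))
          = -W + l * V m + l * ((M.δ q q').toReal * (V q' - V m)) := by
        have : ∀ x, (M.δ q x).toReal * (-W + l * (V m + if x = q' then V q' - V m else 0))
          = (M.δ q x).toReal * (-W + l * V m) +
            if x = q' then l * ((M.δ q x).toReal * (V q' - V m)) else 0 := by
          intro x
          split_ifs <;> ring
        simp_rw [this]
        rw [Finset.sum_add_distrib, ← Finset.sum_mul, pmf_sum]
        simp
      rw [h2]
      have h3 := mul_le_mul_of_nonneg_right (hc q hq q' hE) hu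
      have := mul_le_mul_of_nonneg_left h3 (show (0:ℝ) ≤ l by linarith)
      linarith
  have h5 : c * (V q' - V m) ≤ 2 * (V q - V m + 2 * W) := by
    have : 0 ≤ c * (V q' - V m) := by positivity
    nlinarith
  rw [div_mul_eq_mul_div, le_div_iff₀ hc0]
  linarith

lemma span_bound (hEC : M.IsEndComponent Set.univ) (w : Q → Q → ℤ) :
    ∃ B : ℝ, ∀ l : ℝ, 1 / 2 ≤ l → l < 1 → ∀ V : Q → ℝ, Bell M w l V = V →
      ∀ q q', |V q - V q'| ≤ B := by
  obtain ⟨W, hW0, hW⟩ := exists_wbound w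
  obtain ⟨c, hc0, hc1, hc⟩ := exists_cmin M
  have h1 : ∀ m q : Q, ∃ B : ℝ, 0 ≤ B ∧ ∀ l : ℝ, 1 / 2 ≤ l → l < 1 → ∀ V : Q → ℝ,
      Bell M w l V = V → (∀ q, V m ≤ V q) → V q - V m ≤ B := by
    intro m q
    have := hEC.2.2.2 m (Set.mem_univ _) q (Set.mem_univ _)
    induction this with
    | refl => exact ⟨0, le_rfl, fun l _ _ V _ _ => by simp⟩
    | tail _ h ih =>
      obtain ⟨B, hB0, hB⟩ := ih
      refine ⟨(2 / c) * (B + 2 * W), by positivity, fun l hl hl1 V hV hm => ?_⟩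
      refine (edge_bound M w W hW c hc0 hc1 hc l hl hl1 V hV m hm _ _ h.2.2).trans ?_
      have := hB l hl hl1 V hV hm
      gcongr
  choose B hB0 hB using h1
  refine ⟨∑ m, ∑ q, B m q, fun l hl hl1 V hV => ?_⟩
  have hs : ∀ m q, B m q ≤ ∑ m, ∑ q, B m q := by
    intro m q
    refine le_trans ?_ (Finset.single_le_sum (f := fun m => ∑ q, B m q)
      (fun i _ => Finset.sum_nonneg fun j _ => hB0 i j) (Finset.mem_univ m))
    exact Finset.single_le_sum (f := fun q => B m q) (fun j _ => hB0 m j) (Finset.mem_univ q)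
  intro q q'
  have hQ : Nonempty Q := ⟨q⟩
  obtain ⟨m, hm⟩ := Finite.exists_min V
  have a1 := hB m q l hl hl1 V hV hm
  have a2 := hB m q' l hl hl1 V hV hm
  have a3 := hs m q
  have a4 := hs m q'
  rw [abs_le]
  constructor <;> linarith [hm q, hm q']

lemma acoe (hEC : M.IsEndComponent Set.univ) (w : Q → Q → ℤ) :
    ∃ (g : ℝ) (h : Q → ℝ), ∀ q, Bell M w 1 h q = g + h q := by
  obtain ⟨q0, -⟩ := hEC.1
  obtain ⟨W, hW0, hW⟩ := exists_wbound w
  obtain ⟨B, hB⟩ := span_bound M hEC w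
  let l : ℕ → ℝ := fun n => 1 - 1 / ((n : ℝ) + 2)
  have hl : ∀ n, 1 / 2 ≤ l n := by
    intro n
    have : 1 / ((n : ℝ) + 2) ≤ 1 / 2 := by
      apply one_div_le_one_div_of_le <;> linarith [(Nat.cast_nonneg n : (0:ℝ) ≤ n)]
    simp only [l]; linarith
  have hl1 : ∀ n, l n < 1 := by
    intro n
    have : 0 < 1 / ((n : ℝ) + 2) := by positivity
    simp only [l]; linarith
  have hlt : Tendsto l atTop (nhds 1) := by
    have h2 : Tendsto (fun n : ℕ => 1 / ((n : ℝ) + 2)) atTop (nhds 0) := by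
      have := (tendsto_one_div_add_atTop_nhds_zero_nat (𝕜 := ℝ)).comp (tendsto_add_atTop_nat 1)
      refine this.congr (fun n => ?_)
      simp only [Function.comp]
      push_cast
      ring
    simpa [l] using h2.const_sub 1
  choose V hV using fun n => Bell_fix M w (l n) (by linarith [hl n]) (hl1 n)
  let x : ℕ → ℝ × (Q → ℝ) := fun n => ((1 - l n) * V n q0, fun q => V n q - V n q0)
  have hK : IsCompact (Set.Icc (-W) W ×ˢ Set.pi Set.univ (fun _ : Q => Set.Icc (-B) B)) :=
    isCompact_Icc.prod (isCompact_univ_pi (fun _ => isCompact_Icc))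
  have hx : ∀ n, x n ∈ (Set.Icc (-W) W ×ˢ Set.pi Set.univ (fun _ : Q => Set.Icc (-B) B)) := by
    intro n
    refine ⟨abs_le.1 (Bell_fix_abs M w W hW (l n) (by linarith [hl n]) (hl1 n) (V n) (hV n) q0), ?_⟩
    intro q _
    exact abs_le.1 (hB (l n) (hl n) (hl1 n) (V n) (hV n) q q0)
  obtain ⟨⟨g, h⟩, -, φ, hφ, hlim⟩ := hK.tendsto_subseq hx
  have hg : Tendsto (fun n => (1 - l (φ n)) * V (φ n) q0) atTop (nhds g) :=
    (continuous_fst.tendsto _).comp hlim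
  have hh : ∀ q, Tendsto (fun n => V (φ n) q - V (φ n) q0) atTop (nhds (h q)) := by
    intro q
    have := (((continuous_apply q).comp continuous_snd).tendsto (g, h)).comp hlim
    exact this
  have hll : Tendsto (fun n => l (φ n)) atTop (nhds 1) := hlt.comp hφ.tendsto_atTop
  refine ⟨g, h, fun q => ?_⟩
  have e1 : ∀ n, Bell M w (l (φ n)) (fun q => V (φ n) q - V (φ n) q0) q
      = (1 - l (φ n)) * V (φ n) q0 + (V (φ n) q - V (φ n) q0) := by
    intro n
    have hlp : 0 ≤ l (φ n) := by linarith [hl (φ n)]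
    have b1 := Bell_le M w (l (φ n)) hlp (V (φ n)) (fun q => V (φ n) q - V (φ n) q0)
      (V (φ n) q0) (fun q => by linarith) q
    have b2 := Bell_le M w (l (φ n)) hlp (fun q => V (φ n) q - V (φ n) q0) (V (φ n))
      (- V (φ n) q0) (fun q => by linarith) q
    rw [congrFun (hV (φ n)) q] at b1 b2
    linarith
  have e2 : Tendsto (fun n => Bell M w (l (φ n)) (fun q => V (φ n) q - V (φ n) q0) q) atTop
      (nhds (Bell M w 1 h q)) := by
    unfold Bell
    split_ifs with hq
    · apply Tendsto.finset_sup'_nhds_apply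
      intro i _
      exact (hll.mul (hh i)).const_add _
    · apply tendsto_finsetSum
      intro i _
      exact ((hll.mul (hh i)).const_add _).const_mul _
  refine tendsto_nhds_unique e2 ?_
  simp_rw [e1]
  exact hg.add (hh q)

end ACOE

set_option linter.unusedSectionVars false

section Traj

open ProbabilityTheory

variable [Fintype Q] [MeasurableSpace Q] [MeasurableSingletonClass Q] (M : MDP Q)

lemma pathProb_append (σ : Strategy M) (l : List Q) : ∀ (h : List Q) (q : Q) (x : Q),
    pathProb M σ h q (l ++ [x]) =
      pathProb M σ h q l * M.step σ (h ++ (q :: l).dropLast) ((q :: l).getLast (by simp)) x := by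
  induction l with
  | nil => intro h q x; simp [pathProb]
  | cons a l ih =>
    intro h q x
    simp only [List.cons_append, pathProb]
    rw [ih]
    simp [mul_assoc]

lemma cons_range_map (f : ℕ → Q) (n : ℕ) :
    f 0 :: (List.range n).map (fun i => f (i + 1)) = (List.range (n + 1)).map f := by
  rw [List.range_succ_eq_map]
  simp [Function.comp_def]

lemma pathProb_succ (σ : Strategy M) (f : ℕ → Q) (n : ℕ) :
    pathProb M σ [] (f 0) ((List.range (n + 1)).map fun i => f (i + 1)) =
      pathProb M σ [] (f 0) ((List.range n).map fun i => f (i + 1)) *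
        M.step σ ((List.range n).map f) (f n) (f (n + 1)) := by
  rw [List.range_succ, List.map_append, List.map_singleton, pathProb_append]
  congr 2
  · simp only [cons_range_map]
    congr 1
    · simp [List.range_succ]
    · simp [List.range_succ]

/-- cylinder -/
def cyl (n : ℕ) (f : ℕ → Q) : Set (ℕ → Q) := {ρ | ∀ i ≤ n, ρ i = f i}

lemma cyl_succ (n : ℕ) (f : ℕ → Q) :
    cyl (n + 1) f = cyl n f ∩ {ρ | ρ (n + 1) = f (n + 1)} := by
  ext ρ
  simp only [cyl, Set.mem_ofPred_eq, Set.mem_inter_iff]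
  constructor
  · intro h
    exact ⟨fun i hi => h i (by omega), h _ le_rfl⟩
  · rintro ⟨h1, h2⟩ i hi
    rcases Nat.lt_or_ge n i with h | h
    · have : i = n + 1 := by omega
      rw [this]; exact h2
    · exact h1 i h

lemma measurableSet_cyl (n : ℕ) (f : ℕ → Q) : MeasurableSet (cyl n f) := by
  have : cyl n f = ⋂ i ∈ Finset.range (n + 1), (fun ρ : ℕ → Q => ρ i) ⁻¹' {f i} := by
    ext ρ
    simp [cyl]
  rw [this]
  exact Finset.measurableSet_biInter _ (fun i _ => measurable_pi_apply i (measurableSet_singleton _))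

/-- history of length n before time n, from a prefix -/
def ext (n : ℕ) (x : (i : Finset.Iic n) → Q) : ℕ → Q :=
  fun i => if h : i ≤ n then x ⟨i, Finset.mem_Iic.2 h⟩ else x ⟨n, Finset.mem_Iic.2 le_rfl⟩

noncomputable def ker (σ : Strategy M) (n : ℕ) : Kernel ((i : Finset.Iic n) → Q) Q where
  toFun x := (M.step σ ((List.range n).map (ext n x)) (ext n x n)).toMeasure
  measurable' := by
    have : DiscreteMeasurableSpace ((i : Finset.Iic n) → Q) := inferInstance
    exact Measurable.of_discrete

instance (σ : Strategy M) (n : ℕ) : IsMarkovKernel (ker M σ n) :=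
  ⟨fun x => by unfold ker; exact PMF.toMeasure.isProbabilityMeasure _⟩

lemma exists_traj (σ : Strategy M) (q : Q) : ∃ μ, IsTrajMeasure M σ q μ := by
  let κ : (n : ℕ) → Kernel ((i : Finset.Iic n) → (fun _ : ℕ => Q) i) ((fun _ : ℕ => Q) (n + 1)) := ker M σ
  have hκ : ∀ n, IsMarkovKernel (κ n) := fun n => inferInstanceAs (IsMarkovKernel (ker M σ n))
  let x₀ : (i : Finset.Iic 0) → (fun _ : ℕ => Q) i := fun _ => q
  refine ⟨Kernel.traj κ 0 x₀, inferInstance, fun n f => ?_⟩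
  change Kernel.traj κ 0 x₀ (cyl n f) = _
  induction n with
  | zero =>
    have h := Kernel.traj_map_frestrictLe_of_le (X := fun _ : ℕ => Q) (κ := κ) (le_refl 0)
    have h2 := congrArg (fun k => k x₀ {fun _ => f 0}) h
    beta_reduce at h2
    rw [Kernel.map_apply' _ (by fun_prop) _ (measurableSet_singleton _),
      Kernel.deterministic_apply' _ _ (measurableSet_singleton _)] at h2
    have h3 : cyl 0 f = (Preorder.frestrictLe (π := fun _ : ℕ => Q) 0) ⁻¹' {fun _ => f 0} := by
      ext ρ
      simp only [cyl, Set.mem_ofPred_eq, Set.mem_preimage, Set.mem_singleton_iff]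
      constructor
      · intro h
        funext i
        have hi : (i : ℕ) = 0 := by have := Finset.mem_Iic.1 i.2; omega
        simp [hi, h 0]
      · intro h i hi
        have := congrFun h ⟨0, by simp⟩
        have hi : i = 0 := by omega
        subst hi
        simpa using this
    rw [h3, h2]
    have : Preorder.frestrictLe₂ (π := fun _ : ℕ => Q) (le_refl 0) x₀ ∈ ({fun _ => f 0} : Set ((i : Finset.Iic 0) → Q)) ↔ f 0 = q := by
      simp only [Set.mem_singleton_iff]
      constructor
      · intro h
        exact (congrFun h ⟨0, by simp⟩).symm
      · intro h
        funext i
        simp [x₀, h]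
    simp only [Set.indicator_apply, this]
    simp [pathProb]
  | succ n ih =>
    have h := Kernel.partialTraj_compProd_eq_map_traj (X := fun _ : ℕ => Q) (κ := κ) (Nat.zero_le n) (x₀ := x₀)
    let y : (i : Finset.Iic n) → Q := fun i => f i
    have h2 := congrArg (fun m => m ({y} ×ˢ {f (n + 1)})) h
    beta_reduce at h2
    rw [Measure.map_apply (by fun_prop) ((measurableSet_singleton _).prod (measurableSet_singleton _)),
      Measure.compProd_apply_prod (measurableSet_singleton _) (measurableSet_singleton _),
      ← Kernel.traj_map_frestrictLe_apply, lintegral_singleton,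
      Measure.map_apply (by fun_prop) (measurableSet_singleton _)] at h2
    have h3 : cyl n f = (Preorder.frestrictLe (π := fun _ : ℕ => Q) n) ⁻¹' {y} := by
      ext ρ
      simp only [cyl, Set.mem_ofPred_eq, Set.mem_preimage, Set.mem_singleton_iff]
      constructor
      · intro h
        funext i
        exact h i (Finset.mem_Iic.1 i.2)
      · intro h i hi
        exact congrFun h ⟨i, Finset.mem_Iic.2 hi⟩
    have h4 : cyl (n + 1) f = (fun x : ℕ → Q => (Preorder.frestrictLe (π := fun _ : ℕ => Q) n x, x (n + 1))) ⁻¹' ({y} ×ˢ {f (n + 1)}) := by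
      rw [cyl_succ, h3]
      ext ρ
      simp
    have h5 : κ n y {f (n + 1)} = M.step σ ((List.range n).map f) (f n) (f (n + 1)) := by
      change (M.step σ ((List.range n).map (ext n y)) (ext n y n)).toMeasure {f (n + 1)} = _
      rw [PMF.toMeasure_apply_singleton _ _ (measurableSet_singleton _)]
      have e1 : ext n y n = f n := by simp [ext, y]
      have e2 : (List.range n).map (ext n y) = (List.range n).map f := by
        apply List.map_congr_left
        intro i hi
        have : i ≤ n := (List.mem_range.1 hi).le
        simp [ext, y, this]
      rw [e1, e2]
    rw [h4, ← h2, h5, ← h3, ih]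
    split_ifs with h6
    · subst h6
      rw [pathProb_succ, mul_comm]
    · simp

end Traj

section OneStep

variable [Fintype Q] [MeasurableSpace Q] [MeasurableSingletonClass Q] (M : MDP Q)

/-- `F` depends only on coordinates `≤ n`. -/
def Dep (n : ℕ) (F : (ℕ → Q) → ℝ) : Prop := ∀ ρ ρ' : ℕ → Q, (∀ i ≤ n, ρ i = ρ' i) → F ρ = F ρ'

lemma ext_apply (n : ℕ) (x : (i : Finset.Iic n) → Q) (i : ℕ) (hi : i ≤ n) :
    ext n x i = x ⟨i, Finset.mem_Iic.2 hi⟩ := by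
  simp [ext, hi]

lemma dep_repr (n : ℕ) (F : (ℕ → Q) → ℝ) (hF : Dep n F) :
    F = fun ρ => ∑ x : ((i : Finset.Iic n) → Q),
      (cyl n (ext n x)).indicator (fun _ => F (ext n x)) ρ := by
  funext ρ
  rw [Finset.sum_eq_single (fun i : Finset.Iic n => ρ i)]
  · have h : ∀ i ≤ n, ρ i = ext n (fun i : Finset.Iic n => ρ i) i := fun i hi => by
      rw [ext_apply n _ i hi]
    rw [Set.indicator_of_mem]
    · exact hF _ _ h
    · exact h
  · intro x _ hx
    apply Set.indicator_of_notMem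
    intro h
    apply hx
    funext i
    have hi := Finset.mem_Iic.1 i.2
    have := h i hi
    rw [ext_apply n x i hi] at this
    exact this.symm
  · simp

lemma integrable_dep (μ : Measure (ℕ → Q)) [IsFiniteMeasure μ] (n : ℕ) (F : (ℕ → Q) → ℝ)
    (hF : Dep n F) : Integrable F μ := by
  rw [dep_repr n F hF]
  apply integrable_finsetSum
  intro x _
  exact (integrable_const _).indicator (measurableSet_cyl n _)

lemma int_cyl (μ : Measure (ℕ → Q)) [IsFiniteMeasure μ] (n : ℕ) (F : (ℕ → Q) → ℝ)
    (hF : Dep n F) : ∫ ρ, F ρ ∂μ =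
      ∑ x : ((i : Finset.Iic n) → Q), μ.real (cyl n (ext n x)) * F (ext n x) := by
  conv_lhs => rw [dep_repr n F hF]
  rw [integral_finsetSum]
  · refine Finset.sum_congr rfl fun x _ => ?_
    rw [integral_indicator_const _ (measurableSet_cyl n _), smul_eq_mul]
  · intro x _
    exact (integrable_const _).indicator (measurableSet_cyl n _)

/-- history strictly before time `n`. -/
def hist (ρ : ℕ → Q) (n : ℕ) : List Q := (List.range n).map ρ

lemma hist_congr (ρ ρ' : ℕ → Q) (n : ℕ) (h : ∀ i ≤ n, ρ i = ρ' i) : hist ρ n = hist ρ' n := by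
  apply List.map_congr_left
  intro i hi
  exact h i (List.mem_range.1 hi).le

lemma hist_length (ρ : ℕ → Q) (n : ℕ) : (hist ρ n).length = n := by simp [hist]

/-- one-step expectation -/
noncomputable def Ex (σ : Strategy M) (h : List Q) (q : Q) (u : Q → ℝ) : ℝ :=
  ∑ q', (M.step σ h q q').toReal * u q'

lemma Ex_mono (σ : Strategy M) (h : List Q) (q : Q) (u v : Q → ℝ) (huv : ∀ x, u x ≤ v x) :
    Ex M σ h q u ≤ Ex M σ h q v :=
  Finset.sum_le_sum fun x _ => mul_le_mul_of_nonneg_left (huv x) ENNReal.toReal_nonneg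

lemma cyl_step {σ : Strategy M} {q : Q} {μ : Measure (ℕ → Q)} (hμ : IsTrajMeasure M σ q μ)
    (n : ℕ) (f : ℕ → Q) (q' : Q) :
    μ (cyl n f ∩ {ρ | ρ (n + 1) = q'}) = μ (cyl n f) * M.step σ (hist f n) (f n) q' := by
  let f' : ℕ → Q := Function.update f (n + 1) q'
  have hf' : ∀ i ≤ n, f' i = f i := fun i hi => Function.update_of_ne (by omega) _ _
  have h0 : cyl n f' = cyl n f := by
    ext ρ
    constructor <;> intro h i hi
    · rw [h i hi, hf' i hi]
    · rw [h i hi, hf' i hi]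
  have h1 : cyl (n + 1) f' = cyl n f ∩ {ρ | ρ (n + 1) = q'} := by
    rw [cyl_succ, h0]
    simp [f']
  rw [← h1, ← h0]
  have a1 := hμ.2 (n + 1) f'
  have a2 := hμ.2 n f'
  change μ (cyl _ _) = _ at a1 a2
  rw [a1, a2]
  split_ifs with h
  · rw [← h, pathProb_succ, ← hf' n le_rfl, ← hist_congr f' f n hf']
    simp [hist, f']
  · simp

lemma one_step {σ : Strategy M} {q : Q} {μ : Measure (ℕ → Q)} (hμ : IsTrajMeasure M σ q μ)
    (n : ℕ) (A : (ℕ → Q) → ℝ) (hA : Dep n A) (G : Q → Q → ℝ) :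
    ∫ ρ, A ρ * G (ρ n) (ρ (n + 1)) ∂μ =
      ∫ ρ, A ρ * Ex M σ (hist ρ n) (ρ n) (G (ρ n)) ∂μ := by
  have := hμ.1
  have hm : ∀ q', MeasurableSet {ρ : ℕ → Q | ρ (n + 1) = q'} := fun q' =>
    (measurable_pi_apply (X := fun _ : ℕ => Q) (n + 1)) (measurableSet_singleton q')
  have hd : ∀ q', Dep n (fun ρ => A ρ * G (ρ n) q') := by
    intro q' ρ ρ' h
    simp only
    rw [hA ρ ρ' h, h n le_rfl]
  have h1 : (fun ρ : ℕ → Q => A ρ * G (ρ n) (ρ (n + 1))) =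
      fun ρ => ∑ q', {ρ : ℕ → Q | ρ (n + 1) = q'}.indicator (fun ρ => A ρ * G (ρ n) q') ρ := by
    funext ρ
    rw [Finset.sum_eq_single (ρ (n + 1))]
    · rw [Set.indicator_of_mem]
      rfl
    · intro b _ hb
      apply Set.indicator_of_notMem
      exact fun h => hb h.symm
    · simp
  rw [h1, integral_finsetSum]
  swap
  · intro q' _
    exact (integrable_dep μ n _ (hd q')).indicator (hm q')
  have h2 : ∀ q', ∫ ρ, {ρ : ℕ → Q | ρ (n + 1) = q'}.indicator (fun ρ => A ρ * G (ρ n) q') ρ ∂μ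
      = ∑ x : ((i : Finset.Iic n) → Q), (μ.real (cyl n (ext n x)) *
        (M.step σ (hist (ext n x) n) (ext n x n) q').toReal) * (A (ext n x) * G (ext n x n) q') := by
    intro q'
    rw [integral_indicator (hm q'), int_cyl _ n _ (hd q')]
    refine Finset.sum_congr rfl fun x _ => ?_
    congr 1
    rw [measureReal_def, Measure.restrict_apply (measurableSet_cyl n _), cyl_step M hμ,
      ENNReal.toReal_mul, measureReal_def]
  simp_rw [h2]
  rw [Finset.sum_comm, int_cyl μ n]
  · refine Finset.sum_congr rfl fun x _ => ?_
    unfold Ex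
    rw [Finset.mul_sum, Finset.mul_sum]
    refine Finset.sum_congr rfl fun q' _ => ?_
    ring
  · intro ρ ρ' h
    simp only
    rw [hA ρ ρ' h, h n le_rfl, hist_congr ρ ρ' n h]

lemma one_step_le {σ : Strategy M} {q : Q} {μ : Measure (ℕ → Q)} (hμ : IsTrajMeasure M σ q μ)
    (n : ℕ) (A : (ℕ → Q) → ℝ) (hA : Dep n A) (G : Q → Q → ℝ) (B : Q → ℝ)
    (hB : ∀ ρ : ℕ → Q, A ρ * Ex M σ (hist ρ n) (ρ n) (G (ρ n)) ≤ A ρ * B (ρ n)) :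
    ∫ ρ, A ρ * G (ρ n) (ρ (n + 1)) ∂μ ≤ ∫ ρ, A ρ * B (ρ n) ∂μ := by
  have := hμ.1
  rw [one_step M hμ n A hA G]
  apply integral_mono
  · apply integrable_dep μ n
    intro ρ ρ' h
    simp only
    rw [hA ρ ρ' h, h n le_rfl, hist_congr ρ ρ' n h]
  · apply integrable_dep μ n
    intro ρ ρ' h
    simp only
    rw [hA ρ ρ' h, h n le_rfl]
  · exact hB

/-- partial sums -/
def PS (Z : ℕ → Q → Q → ℝ) (n : ℕ) (ρ : ℕ → Q) : ℝ :=
  ∑ i ∈ Finset.range n, Z i (ρ i) (ρ (i + 1))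

lemma PS_dep (Z : ℕ → Q → Q → ℝ) (n : ℕ) : Dep n (PS Z n) := by
  intro ρ ρ' h
  refine Finset.sum_congr rfl fun i hi => ?_
  have := Finset.mem_range.1 hi
  rw [h i (by omega), h (i + 1) (by omega)]

lemma exp_moment {σ : Strategy M} {q : Q} {μ : Measure (ℕ → Q)} (hμ : IsTrajMeasure M σ q μ)
    (Z : ℕ → Q → Q → ℝ) (K : ℝ) (hZK : ∀ n x y, |Z n x y| ≤ K)
    (hZ : ∀ (h : List Q) x, 0 ≤ Ex M σ h x (Z h.length x))
    (θ : ℝ) (hθ : 0 ≤ θ) (hθK : θ * K ≤ 1) (n : ℕ) :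
    ∫ ρ, Real.exp (-θ * PS Z n ρ) ∂μ ≤ (1 + θ ^ 2 * K ^ 2) ^ n := by
  have := hμ.1
  induction n with
  | zero => simp [PS]
  | succ n ih =>
    have e1 : ∀ ρ : ℕ → Q, Real.exp (-θ * PS Z (n + 1) ρ) =
        Real.exp (-θ * PS Z n ρ) * (fun x y => Real.exp (-θ * Z n x y)) (ρ n) (ρ (n + 1)) := by
      intro ρ
      simp only
      rw [← Real.exp_add]
      congr 1
      unfold PS
      rw [Finset.sum_range_succ]
      ring
    simp_rw [e1]
    refine (one_step_le M hμ n _ ?_ (fun x y => Real.exp (-θ * Z n x y))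
      (fun _ => 1 + θ ^ 2 * K ^ 2) ?_).trans ?_
    · intro ρ ρ' h
      simp only
      rw [PS_dep Z n ρ ρ' h]
    · intro ρ
      apply mul_le_mul_of_nonneg_left _ (Real.exp_pos _).le
      set h := hist ρ n
      have hlen : h.length = n := hist_length ρ n
      have h1 := hZ h (ρ n)
      rw [hlen] at h1
      have hb : ∀ y, Real.exp (-θ * Z n (ρ n) y) ≤ (1 + θ ^ 2 * K ^ 2) + (-θ) * Z n (ρ n) y := by
        intro y
        have hz := hZK n (ρ n) y
        have habs : |-θ * Z n (ρ n) y| ≤ θ * K := by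
          rw [abs_mul, abs_neg, abs_of_nonneg hθ]
          exact mul_le_mul_of_nonneg_left hz hθ
        have h2 := Real.abs_exp_sub_one_sub_id_le (habs.trans hθK)
        have h3 := (abs_le.1 h2).2
        have h4 : (-θ * Z n (ρ n) y) ^ 2 ≤ (θ * K) ^ 2 := sq_le_sq' (abs_le.1 habs).1 (abs_le.1 habs).2
        nlinarith
      refine (Ex_mono M σ h (ρ n) _ _ hb).trans ?_
      have h5 : Ex M σ h (ρ n) (fun y => (1 + θ ^ 2 * K ^ 2) + (-θ) * Z n (ρ n) y)
          = (1 + θ ^ 2 * K ^ 2) - θ * Ex M σ h (ρ n) (Z n (ρ n)) := by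
        unfold Ex
        simp_rw [mul_add _ _ ((-θ) * _)]
        rw [Finset.sum_add_distrib, ← Finset.sum_mul, pmf_sum, Finset.mul_sum, one_mul,
          sub_eq_add_neg, ← Finset.sum_neg_distrib]
        congr 1
        refine Finset.sum_congr rfl fun x _ => ?_
        ring
      rw [h5]
      nlinarith [mul_nonneg hθ h1]
    · rw [integral_mul_const, pow_succ]
      exact mul_le_mul_of_nonneg_right ih (by positivity)

lemma chernoff {σ : Strategy M} {q : Q} {μ : Measure (ℕ → Q)} (hμ : IsTrajMeasure M σ q μ)
    (Z : ℕ → Q → Q → ℝ) (K : ℝ) (hZK : ∀ n x y, |Z n x y| ≤ K)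
    (hZ : ∀ (h : List Q) x, 0 ≤ Ex M σ h x (Z h.length x))
    (ε : ℝ) (hε : 0 < ε) :
    ∀ᵐ ρ ∂μ, ∀ᶠ n : ℕ in atTop, -ε * n ≤ PS Z n ρ := by
  have := hμ.1
  let K' := max K (max 1 ε)
  have hK1 : 1 ≤ K' := (le_max_left 1 ε).trans (le_max_right _ _)
  have hKε : ε ≤ K' := (le_max_right 1 ε).trans (le_max_right _ _)
  have hK : ∀ n x y, |Z n x y| ≤ K' := fun n x y => (hZK n x y).trans (le_max_left _ _)
  have hK0 : 0 < K' := by linarith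
  let θ := ε / (2 * K' ^ 2)
  have hθ : 0 < θ := by positivity
  have hθ2 : θ * (2 * K' ^ 2) = ε := by simp only [θ]; field_simp
  have hθK : θ * K' ≤ 1 := by
    have : θ * K' * (2 * K') ≤ 1 * (2 * K') := by nlinarith
    exact le_of_mul_le_mul_right this (by positivity)
  let r := Real.exp (-(θ * ε / 2))
  have hr1 : r < 1 := Real.exp_lt_one_iff.2 (by have := mul_pos hθ hε; linarith)
  have hr0 : 0 ≤ r := (Real.exp_pos _).le
  have hP : ∀ n : ℕ, μ.real {ρ | Real.exp (θ * ε * n) ≤ Real.exp (-θ * PS Z n ρ)} ≤ r ^ n := by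
    intro n
    have h1 := exp_moment M hμ Z K' hK hZ θ hθ.le hθK n
    have h2 := mul_meas_ge_le_integral_of_nonneg (μ := μ)
      (f := fun ρ => Real.exp (-θ * PS Z n ρ)) (Eventually.of_forall fun ρ => (Real.exp_pos _).le)
      (integrable_dep μ n _ (fun ρ ρ' h => by rw [PS_dep Z n ρ ρ' h]))
      (Real.exp (θ * ε * n))
    have h3 : (1 + θ ^ 2 * K' ^ 2) ^ n ≤ Real.exp (θ * ε / 2 * n) := by
      have : 1 + θ ^ 2 * K' ^ 2 ≤ Real.exp (θ * ε / 2) := by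
        have := Real.add_one_le_exp (θ * ε / 2)
        have h4 : θ ^ 2 * K' ^ 2 = θ * ε / 2 := by rw [← hθ2]; ring
        linarith
      calc _ ≤ (Real.exp (θ * ε / 2)) ^ n := by gcongr
        _ = _ := by rw [← Real.exp_nat_mul]; ring_nf
    have h5 : r ^ n = Real.exp (θ * ε / 2 * n) / Real.exp (θ * ε * n) := by
      simp only [r]
      rw [← Real.exp_nat_mul, ← Real.exp_sub]
      ring_nf
    rw [h5, le_div_iff₀ (Real.exp_pos _), mul_comm]
    exact h2.trans (h1.trans h3)
  have hsum : ∑' n : ℕ, μ {ρ | Real.exp (θ * ε * n) ≤ Real.exp (-θ * PS Z n ρ)} ≠ ⊤ := by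
    have hle : ∀ n : ℕ, μ {ρ | Real.exp (θ * ε * n) ≤ Real.exp (-θ * PS Z n ρ)}
        ≤ ENNReal.ofReal (r ^ n) := by
      intro n
      rw [← ofReal_measureReal]
      exact ENNReal.ofReal_le_ofReal (hP n)
    refine ne_top_of_le_ne_top ?_ (ENNReal.tsum_le_tsum hle)
    exact (summable_geometric_of_lt_one hr0 hr1).tsum_ofReal_ne_top
  filter_upwards [ae_eventually_notMem hsum] with ρ hρ
  filter_upwards [hρ] with n hn
  by_contra hcon
  apply hn
  push Not at hcon
  simp only [Real.exp_le_exp]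
  nlinarith

end OneStep

section Final

variable [Fintype Q] [MeasurableSpace Q] [MeasurableSingletonClass Q] (M : MDP Q)

/-- there is a path of length exactly `j` to `t` -/
def RR (t : Q) : ℕ → Q → Prop
  | 0, q => q = t
  | j + 1, q => ∃ q', M.E q q' ∧ RR t j q'

lemma exists_dist (hEC : M.IsEndComponent Set.univ) (t : Q) :
    ∃ (d : Q → ℕ) (r : Q → Q), (∀ q, d q = 0 → q = t) ∧ (∀ q, M.E q (r q)) ∧
      ∀ q, q ≠ t → d (r q) < d q := by
  have hex : ∀ q, ∃ j, RR M t j q := by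
    intro q
    have := hEC.2.2.2 q (Set.mem_univ _) t (Set.mem_univ _)
    induction this using Relation.ReflTransGen.head_induction_on with
    | refl => exact ⟨0, rfl⟩
    | head h _ ih =>
      obtain ⟨j, hj⟩ := ih
      exact ⟨j + 1, _, h.2.2, hj⟩
  let d : Q → ℕ := fun q => Nat.find (hex q)
  have hd : ∀ q, RR M t (d q) q := fun q => Nat.find_spec (hex q)
  have hstep : ∀ q, ∃ q', M.E q q' ∧ (q ≠ t → d q' < d q) := by
    intro q
    by_cases hq : q = t
    · obtain ⟨q', h⟩ := M.E_nonempty q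
      exact ⟨q', h, fun h => absurd hq h⟩
    · have h1 := hd q
      rcases hk : d q with _ | k
      · rw [hk] at h1
        exact absurd h1 hq
      · rw [hk] at h1
        obtain ⟨q', h2, h3⟩ := h1
        exact ⟨q', h2, fun _ => Nat.lt_succ_of_le (Nat.find_min' (hex q') h3)⟩
  choose r hr using hstep
  refine ⟨d, r, fun q hq => ?_, fun q => (hr q).1, fun q => (hr q).2⟩
  have := hd q
  rw [hq] at this
  exact this

lemma EL_abs (w : Q → Q → ℤ) (W : ℝ) (hW : ∀ q q', |(w q q' : ℝ)| ≤ W) (ρ : ℕ → Q) (n : ℕ) :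
    |(EL w ρ n : ℝ)| ≤ n * W := by
  unfold EL
  push_cast
  refine (Finset.abs_sum_le_sum_abs _ _).trans ?_
  refine (Finset.sum_le_sum (fun i _ => hW _ _)).trans ?_
  simp

lemma EL_div_abs (w : Q → Q → ℤ) (W : ℝ) (hW0 : 0 ≤ W) (hW : ∀ q q', |(w q q' : ℝ)| ≤ W)
    (ρ : ℕ → Q) (n : ℕ) : |(EL w ρ n : ℝ) / n| ≤ W := by
  rw [abs_div, Nat.abs_cast]
  apply div_le_of_le_mul₀ (by positivity) hW0
  rw [mul_comm]
  exact EL_abs w W hW ρ n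

lemma bdd_ge (w : Q → Q → ℤ) (ρ : ℕ → Q) :
    IsBoundedUnder (· ≥ ·) atTop (fun n : ℕ => (EL w ρ n : ℝ) / n) := by
  obtain ⟨W, hW0, hW⟩ := exists_wbound w
  exact isBoundedUnder_of ⟨-W, fun n => (abs_le.1 (EL_div_abs w W hW0 hW ρ n)).1⟩

lemma bdd_le (w : Q → Q → ℤ) (ρ : ℕ → Q) :
    IsBoundedUnder (· ≤ ·) atTop (fun n : ℕ => (EL w ρ n : ℝ) / n) := by
  obtain ⟨W, hW0, hW⟩ := exists_wbound w
  exact isBoundedUnder_of ⟨W, fun n => (abs_le.1 (EL_div_abs w W hW0 hW ρ n)).2⟩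

lemma MP_ge (w : Q → Q → ℤ) (ρ : ℕ → Q) (x : ℝ)
    (h : ∀ k : ℕ, ∀ᶠ n : ℕ in atTop, (x - 1 / ((k : ℝ) + 1)) * n ≤ EL w ρ n) : x ≤ MP w ρ := by
  have h1 : ∀ k : ℕ, x - 1 / ((k : ℝ) + 1) ≤ MP w ρ := by
    intro k
    apply le_liminf_of_le (bdd_le w ρ).isCoboundedUnder_ge
    filter_upwards [h k, eventually_gt_atTop 0] with n hn hn0
    rw [le_div_iff₀ (by exact_mod_cast hn0)]
    exact hn
  have h2 : Tendsto (fun k : ℕ => x - 1 / ((k : ℝ) + 1)) atTop (nhds (x - 0)) :=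
    (tendsto_one_div_add_atTop_nhds_zero_nat (𝕜 := ℝ)).const_sub x
  rw [sub_zero] at h2
  exact le_of_tendsto' h2 h1

lemma MP_le (w : Q → Q → ℤ) (ρ : ℕ → Q) (x : ℝ)
    (h : ∀ k : ℕ, ∀ᶠ n : ℕ in atTop, EL w ρ n ≤ (x + 1 / ((k : ℝ) + 1)) * n) : MP w ρ ≤ x := by
  have h1 : ∀ k : ℕ, MP w ρ ≤ x + 1 / ((k : ℝ) + 1) := by
    intro k
    apply liminf_le_of_le (bdd_ge w ρ)
    intro b hb
    obtain ⟨n, hn1, hn2, hn3⟩ := (hb.and ((h k).and (eventually_gt_atTop 0))).exists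
    refine hn1.trans ?_
    rw [div_le_iff₀ (by exact_mod_cast hn3)]
    exact hn2
  have h2 : Tendsto (fun k : ℕ => x + 1 / ((k : ℝ) + 1)) atTop (nhds (x + 0)) :=
    (tendsto_one_div_add_atTop_nhds_zero_nat (𝕜 := ℝ)).const_add x
  rw [add_zero] at h2
  exact ge_of_tendsto' h2 h1

lemma measurable_EL (w : Q → Q → ℤ) (n : ℕ) : Measurable (fun ρ : ℕ → Q => (EL w ρ n : ℝ) / n) := by
  unfold EL
  push_cast
  apply Measurable.div_const
  apply Finset.measurable_sum
  intro i _
  have h1 : Measurable (fun x : Q × Q => (w x.1 x.2 : ℝ)) := Measurable.of_discrete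
  have h2 : Measurable (fun ρ : ℕ → Q => (ρ i, ρ (i + 1))) := by fun_prop
  exact h1.comp h2

lemma measurable_MP (w : Q → Q → ℤ) : Measurable (fun ρ : ℕ → Q => MP w ρ) := by
  have : (fun ρ : ℕ → Q => MP w ρ) =
      fun ρ => liminf (fun n : ℕ => (EL w ρ n : ℝ) / n) atTop := rfl
  rw [this]
  have hs : (fun ρ : ℕ → Q => liminf (fun n : ℕ => (EL w ρ n : ℝ) / n) atTop) =
      fun ρ => liminf (fun n : ℕ => (fun n (ρ : ℕ → Q) => (EL w ρ n : ℝ) / n) n ρ) atTop := rfl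
  rw [hs]
  exact Measurable.liminf (fun n => measurable_EL w n)

lemma integrable_MP (w : Q → Q → ℤ) (μ : Measure (ℕ → Q)) [IsFiniteMeasure μ] :
    Integrable (fun ρ => MP w ρ) μ := by
  obtain ⟨W, hW0, hW⟩ := exists_wbound w
  refine Integrable.of_bound (measurable_MP w).aestronglyMeasurable W (Eventually.of_forall ?_)
  intro ρ
  rw [Real.norm_eq_abs, abs_le]
  constructor
  · apply le_liminf_of_le (bdd_le w ρ).isCoboundedUnder_ge
    exact Eventually.of_forall fun n => (abs_le.1 (EL_div_abs w W hW0 hW ρ n)).1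
  · apply liminf_le_of_le (bdd_ge w ρ)
    intro b hb
    obtain ⟨n, hn⟩ := hb.exists
    exact hn.trans (abs_le.1 (EL_div_abs w W hW0 hW ρ n)).2

lemma fin_bound2 (f : Q → Q → ℝ) : ∃ K : ℝ, 0 ≤ K ∧ ∀ q q', |f q q'| ≤ K := by
  refine ⟨∑ q, ∑ q', |f q q'|, by positivity, fun q q' => ?_⟩
  refine le_trans ?_ (Finset.single_le_sum (f := fun q => ∑ q', |f q q'|)
    (fun i _ => by positivity) (Finset.mem_univ q))
  exact Finset.single_le_sum (f := fun q' => |f q q'|)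
    (fun i _ => by positivity) (Finset.mem_univ q')

/-- telescoping -/
lemma PS_tel (w : Q → Q → ℤ) (g : ℝ) (H : Q → ℝ) (ρ : ℕ → Q) (n : ℕ) :
    ∑ i ∈ Finset.range n, ((w (ρ i) (ρ (i + 1)) : ℝ) + H (ρ (i + 1)) - H (ρ i) - g)
      = EL w ρ n + (H (ρ n) - H (ρ 0)) - n * g := by
  induction n with
  | zero => simp [EL]
  | succ n ih =>
    rw [Finset.sum_range_succ, ih]
    unfold EL
    rw [Finset.sum_range_succ]
    push_cast
    ring

lemma Ex_split (σ : Strategy M) (h : List Q) (x : Q) (u : Q → ℝ) (a b : ℝ) :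
    Ex M σ h x (fun y => u y - a - b) = Ex M σ h x u - a - b := by
  unfold Ex
  simp_rw [sub_sub, mul_sub]
  rw [Finset.sum_sub_distrib, ← Finset.sum_mul, pmf_sum, one_mul]

lemma Ex_upper (w : Q → Q → ℤ) (g : ℝ) (H : Q → ℝ) (hB : ∀ q, Bell M w 1 H q = g + H q)
    (σ : Strategy M) (h : List Q) (x : Q) :
    Ex M σ h x (fun y => (w x y : ℝ) + H y) ≤ g + H x := by
  rw [← hB x]
  unfold Ex Bell MDP.step
  split_ifs with hx
  · set s := (succs M x).sup' (succs_ne M x) (fun q' => (w x q' : ℝ) + 1 * H q') with hs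
    calc _ ≤ ∑ y, (σ.act h x y).toReal * s := by
          apply Finset.sum_le_sum
          intro y _
          by_cases hy : y ∈ (σ.act h x).support
          · apply mul_le_mul_of_nonneg_left _ ENNReal.toReal_nonneg
            have := Finset.le_sup' (s := succs M x) (fun q' => (w x q' : ℝ) + 1 * H q')
              (b := y) (by simp [succs, σ.act_support h x hx y hy])
            rw [← hs] at this
            have this2 : (w x y : ℝ) + 1 * H y ≤ s := this
            linarith
          · rw [PMF.mem_support_iff, not_not] at hy
            simp [hy]
      _ = s := by rw [← Finset.sum_mul, pmf_sum, one_mul]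
  · simp

lemma val_le (hEC : M.IsEndComponent Set.univ) (w : Q → Q → ℤ) (g : ℝ) (H : Q → ℝ)
    (hB : ∀ q, Bell M w 1 H q = g + H q) (q : Q) : ValMP M w q ≤ g := by
  have hσ : ∃ σ : Strategy M, True := by
    choose r hr using M.E_nonempty
    refine ⟨⟨fun _ q => PMF.pure (r q), fun h q _ q' hq' => ?_⟩, trivial⟩
    rw [PMF.support_pure, Set.mem_singleton_iff] at hq'
    rw [hq']
    exact hr q
  obtain ⟨σ0, -⟩ := hσ
  obtain ⟨μ0, hμ0⟩ := exists_traj M σ0 q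
  unfold ValMP
  refine csSup_le ⟨∫ ρ, MP w ρ ∂μ0, σ0, μ0, hμ0, rfl⟩ ?_
  rintro x ⟨σ, μ, hμ, rfl⟩
  have := hμ.1
  let Z : ℕ → Q → Q → ℝ := fun _ x y => -((w x y : ℝ) + H y - H x - g)
  obtain ⟨K, hK0, hK⟩ := fin_bound2 (fun x y => (w x y : ℝ) + H y - H x - g)
  obtain ⟨B, hB0, hBH⟩ := fin_bound2 (fun x y => H y - H x)
  have hae : ∀ᵐ ρ ∂μ, MP w ρ ≤ g := by
    have h1 : ∀ k : ℕ, ∀ᵐ ρ ∂μ, ∀ᶠ n : ℕ in atTop, -(1 / (2 * ((k : ℝ) + 1))) * n ≤ PS Z n ρ := by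
      intro k
      refine chernoff M hμ Z K ?_ ?_ _ (by positivity)
      · intro n x y
        simp only [Z, abs_neg]
        exact hK x y
      · intro h x
        have e : Ex M σ h x (Z h.length x) =
            -(Ex M σ h x (fun y => ((w x y : ℝ) + H y) - H x - g)) := by
          unfold Ex
          rw [← Finset.sum_neg_distrib]
          refine Finset.sum_congr rfl fun y _ => ?_
          simp only [Z]
          ring
        rw [e, Ex_split]
        linarith [Ex_upper M w g H hB σ h x]
    rw [← ae_all_iff] at h1
    filter_upwards [h1] with ρ hρ
    apply MP_le
    intro k
    obtain ⟨m, hm⟩ := exists_nat_ge (2 * ((k : ℝ) + 1) * B)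
    filter_upwards [hρ k, eventually_ge_atTop m] with n hn hnm
    have e : PS Z n ρ = -(EL w ρ n + (H (ρ n) - H (ρ 0)) - n * g) := by
      rw [← PS_tel]
      simp only [PS, Z, Finset.sum_neg_distrib]
    rw [e] at hn
    have h3 := (abs_le.1 (hBH (ρ 0) (ρ n))).1
    have h4 : (m : ℝ) ≤ n := by exact_mod_cast hnm
    have h5 : B ≤ 1 / (2 * ((k : ℝ) + 1)) * n := by
      rw [div_mul_eq_mul_div, one_mul, le_div_iff₀ (by positivity)]
      linarith
    have h6 : 1 / ((k : ℝ) + 1) = 1 / (2 * ((k : ℝ) + 1)) + 1 / (2 * ((k : ℝ) + 1)) := by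
      field_simp; norm_num
    rw [h6]
    linarith
  calc ∫ ρ, MP w ρ ∂μ ≤ ∫ _, g ∂μ := integral_mono_ae (integrable_MP w μ) (integrable_const _) hae
    _ = g := by simp

/-- the sparse schedule -/
def Sch (L n : ℕ) : Prop := n < Nat.sqrt n ^ 2 + L

lemma sch_count (L n : ℕ) :
    ((Finset.range n).filter (fun i => Sch L i)).card ≤ (Nat.sqrt n + 1) * L := by
  have : ((Finset.range n).filter (fun i => Sch L i)).card ≤
      (Finset.range (Nat.sqrt n + 1) ×ˢ Finset.range L).card := by
    apply Finset.card_le_card_of_injOn (fun i => (Nat.sqrt i, i - Nat.sqrt i ^ 2))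
    · intro i hi
      have hi' := Finset.mem_filter.1 (Finset.mem_coe.1 hi)
      have hin := Finset.mem_range.1 hi'.1
      have hS : i < Nat.sqrt i ^ 2 + L := hi'.2
      have h1 : Nat.sqrt i ≤ Nat.sqrt n := Nat.sqrt_le_sqrt hin.le
      have h2 : Nat.sqrt i ^ 2 ≤ i := Nat.sqrt_le' i
      exact Finset.mem_coe.2 (Finset.mem_product.2
        ⟨Finset.mem_range.2 (by dsimp only; omega), Finset.mem_range.2 (by dsimp only; omega)⟩)
    · intro i _ j _ hij
      simp only [Prod.mk.injEq] at hij
      have h1 : Nat.sqrt i ^ 2 ≤ i := Nat.sqrt_le' i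
      have h2 : Nat.sqrt j ^ 2 ≤ j := Nat.sqrt_le' j
      rw [hij.1] at h1
      have h3 := hij.2
      rw [hij.1] at h3
      omega
  simpa using this

lemma sch_small (L : ℕ) (C ε : ℝ) (hC : 0 ≤ C) (hε : 0 < ε) : ∀ᶠ n : ℕ in atTop,
    C * ((Finset.range n).filter (fun i => Sch L i)).card ≤ ε * n := by
  obtain ⟨m, hm⟩ := exists_nat_ge (2 * L * C / ε)
  rw [div_le_iff₀ hε] at hm
  filter_upwards [eventually_ge_atTop ((m + 1) * (m + 1))] with n hn
  have h1 : m + 1 ≤ Nat.sqrt n := Nat.le_sqrt.2 hn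
  have h2 : (((Finset.range n).filter (fun i => Sch L i)).card : ℝ) ≤ (Nat.sqrt n + 1) * L := by
    exact_mod_cast sch_count L n
  have h3 : (Nat.sqrt n : ℝ) * Nat.sqrt n ≤ n := by exact_mod_cast Nat.sqrt_le n
  have h4 : (m : ℝ) + 1 ≤ Nat.sqrt n := by exact_mod_cast h1
  set s : ℝ := (Nat.sqrt n : ℝ)
  have hm0 : (0 : ℝ) ≤ m := Nat.cast_nonneg m
  have hL0 : (0 : ℝ) ≤ L := Nat.cast_nonneg L
  calc C * ((Finset.range n).filter (fun i => Sch L i)).card ≤ C * ((s + 1) * L) := by gcongr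
    _ ≤ C * ((s + s) * L) := by gcongr; linarith
    _ = s * (2 * L * C) := by ring
    _ ≤ s * (m * ε) := by gcongr
    _ ≤ s * (s * ε) := by gcongr; linarith
    _ = ε * (s * s) := by ring
    _ ≤ ε * n := by gcongr

/-- indicator of not visiting `t` in `[N, n]` -/
noncomputable def II (t : Q) (N n : ℕ) (ρ : ℕ → Q) : ℝ :=
  if ∀ i, N ≤ i → i ≤ n → ρ i ≠ t then 1 else 0

lemma II_dep (t : Q) (N n : ℕ) : Dep n (II t N n) := by
  intro ρ ρ' h
  unfold II
  have : (∀ i, N ≤ i → i ≤ n → ρ i ≠ t) ↔ (∀ i, N ≤ i → i ≤ n → ρ' i ≠ t) := by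
    constructor <;> intro h1 i hi hi'
    · rw [← h i hi']; exact h1 i hi hi'
    · rw [h i hi']; exact h1 i hi hi'
  simp only [this]

lemma II_nonneg (t : Q) (N n : ℕ) (ρ : ℕ → Q) : 0 ≤ II t N n ρ := by
  unfold II; split_ifs <;> norm_num

lemma II_anti (t : Q) (N n m : ℕ) (h : n ≤ m) (ρ : ℕ → Q) : II t N m ρ ≤ II t N n ρ := by
  unfold II
  split_ifs with h1 h2
  · exact le_rfl
  · exact absurd (fun i hi hi' => h1 i hi (hi'.trans h)) h2
  · norm_num
  · exact le_rfl

noncomputable def phi (c : ℝ) (d : Q → ℕ) (j : ℕ) (q : Q) : ℝ := if d q ≤ j then 1 - c ^ j else 1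

lemma visit_block {σ : Strategy M} {q : Q} {μ : Measure (ℕ → Q)} (hμ : IsTrajMeasure M σ q μ)
    (t : Q) (d : Q → ℕ) (r : Q → Q) (c : ℝ) (hc0 : 0 < c) (hc1 : c ≤ 1) (S : ℕ → Prop)
    (hd : ∀ x, x ≠ t → d (r x) < d x)
    (hstep : ∀ (h : List Q) x, S h.length → x ≠ t → c ≤ (M.step σ h x (r x)).toReal)
    (N s : ℕ) (hs : N ≤ s) (j : ℕ) : ∀ i, (∀ k < j, S (s + k)) →
    ∫ ρ, II t N (s + j) ρ * phi c d i (ρ (s + j)) ∂μ ≤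
      ∫ ρ, II t N s ρ * phi c d (i + j) (ρ s) ∂μ := by
  have := hμ.1
  have hphi0 : ∀ i x, 0 ≤ phi c d i x := by
    intro i x
    unfold phi
    split_ifs
    · linarith [pow_le_one₀ (n := i) hc0.le hc1]
    · norm_num
  have hphi1 : ∀ i x, phi c d i x ≤ 1 := by
    intro i x
    unfold phi
    split_ifs
    · linarith [pow_pos hc0 i]
    · norm_num
  induction j with
  | zero => intro i _; simp
  | succ j ih =>
    intro i hS
    refine le_trans ?_ ((ih (i + 1) (fun k hk => hS k (by omega))).trans_eq
      (by rw [show i + 1 + j = i + (j + 1) by ring]))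
    rw [show s + (j + 1) = s + j + 1 by ring]
    have hSj := hS j (by omega)
    set n := s + j with hn
    have step1 : ∫ ρ, II t N (n + 1) ρ * phi c d i (ρ (n + 1)) ∂μ ≤
        ∫ ρ, II t N n ρ * (fun _ y => phi c d i y) (ρ n) (ρ (n + 1)) ∂μ := by
      apply integral_mono
      · apply integrable_dep μ (n + 1)
        intro ρ ρ' h
        simp only
        rw [II_dep t N (n + 1) ρ ρ' h, h (n + 1) le_rfl]
      · apply integrable_dep μ (n + 1)
        intro ρ ρ' h
        simp only
        rw [II_dep t N n ρ ρ' (fun i hi => h i (by omega)), h (n + 1) le_rfl]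
      · intro ρ
        exact mul_le_mul_of_nonneg_right (II_anti t N n (n + 1) (by omega) ρ) (hphi0 _ _)
    refine step1.trans ?_
    refine one_step_le M hμ n (II t N n) (II_dep t N n) (fun _ y => phi c d i y)
      (phi c d (i + 1)) ?_
    intro ρ
    by_cases hI : ∀ i, N ≤ i → i ≤ n → ρ i ≠ t
    swap
    · simp [II, hI]
    apply mul_le_mul_of_nonneg_left _ (II_nonneg _ _ _ _)
    have hρ : ρ n ≠ t := hI n (by omega) le_rfl
    set h := hist ρ n
    have hlen : h.length = n := hist_length ρ n
    have hE1 : Ex M σ h (ρ n) (fun _ => 1) = 1 := by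
      unfold Ex
      rw [← Finset.sum_mul, pmf_sum, one_mul]
    have hc' := hstep h (ρ n) (by rw [hlen]; exact hSj) hρ
    by_cases hdn : d (ρ n) ≤ i + 1
    · have e1 : phi c d (i + 1) (ρ n) = 1 - c ^ (i + 1) := if_pos hdn
      rw [e1]
      have hb : ∀ y, phi c d i y ≤ 1 - (if y = r (ρ n) then c ^ i else 0) := by
        intro y
        split_ifs with hy
        · subst hy
          have : d (r (ρ n)) ≤ i := by have := hd _ hρ; omega
          simp [phi, this]
        · simpa using hphi1 i y
      refine (Ex_mono M σ h (ρ n) _ _ hb).trans ?_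
      have e2 : Ex M σ h (ρ n) (fun y => 1 - (if y = r (ρ n) then c ^ i else 0)) =
          1 - (M.step σ h (ρ n) (r (ρ n))).toReal * c ^ i := by
        unfold Ex
        simp_rw [mul_sub, mul_one]
        rw [Finset.sum_sub_distrib, pmf_sum]
        simp
      rw [e2, pow_succ]
      nlinarith [mul_le_mul_of_nonneg_right hc' (pow_pos hc0 i).le]
    · have e1 : phi c d (i + 1) (ρ n) = 1 := if_neg hdn
      rw [e1, ← hE1]
      exact Ex_mono M σ h (ρ n) _ _ (hphi1 i)

lemma visit {σ : Strategy M} {q : Q} {μ : Measure (ℕ → Q)} (hμ : IsTrajMeasure M σ q μ)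
    (t : Q) (d : Q → ℕ) (r : Q → Q) (c : ℝ) (hc0 : 0 < c) (hc1 : c ≤ 1) (L : ℕ)
    (hdL : ∀ x, d x ≤ L) (hd0 : ∀ x, d x = 0 → x = t)
    (hd : ∀ x, x ≠ t → d (r x) < d x)
    (hstep : ∀ (h : List Q) x, Sch L h.length → x ≠ t → c ≤ (M.step σ h x (r x)).toReal) :
    ∀ᵐ ρ ∂μ, ∀ N, ∃ n, N ≤ n ∧ ρ n = t := by
  have := hμ.1
  rw [ae_all_iff]
  intro N
  let γ := 1 - c ^ L
  have hγ0 : 0 ≤ γ := by have := pow_le_one₀ (n := L) hc0.le hc1; simp only [γ]; linarith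
  have hγ1 : γ < 1 := by have := pow_pos hc0 L; simp only [γ]; linarith
  let k0 := N + L
  have hint : ∀ n, Integrable (II t N n) μ := fun n => integrable_dep μ n _ (II_dep t N n)
  have hsch : ∀ k, L ≤ k → ∀ i < L, Sch L (k ^ 2 + i) := by
    intro k hk i hi
    have : Nat.sqrt (k ^ 2 + i) = k := by
      rw [pow_two]
      exact Nat.sqrt_add_eq k (by omega)
    unfold Sch
    rw [this]
    omega
  have hblock : ∀ j, ∫ ρ, II t N ((k0 + j) ^ 2) ρ ∂μ ≤ γ ^ j := by
    intro j
    induction j with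
    | zero =>
      calc _ ≤ ∫ _, (1 : ℝ) ∂μ := by
            apply integral_mono (hint _) (integrable_const _)
            intro ρ
            unfold II
            beta_reduce
            split_ifs <;> norm_num
        _ = _ := by simp
    | succ j ih =>
      have hs : N ≤ (k0 + j) ^ 2 := by
        have : k0 + j ≤ (k0 + j) ^ 2 := Nat.le_self_pow (by norm_num) _
        omega
      have h1 := visit_block M hμ t d r c hc0 hc1 (Sch L) hd hstep N ((k0 + j) ^ 2) hs L 0
        (fun i hi => hsch (k0 + j) (by omega) i hi)
      have hle : (k0 + j) ^ 2 + L ≤ (k0 + (j + 1)) ^ 2 := by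
        have : L ≤ k0 := by omega
        have e : (k0 + (j + 1)) ^ 2 = (k0 + j) ^ 2 + 2 * (k0 + j) + 1 := by ring
        omega
      have h2 : ∫ ρ, II t N ((k0 + (j + 1)) ^ 2) ρ ∂μ ≤
          ∫ ρ, II t N ((k0 + j) ^ 2 + L) ρ * phi c d 0 (ρ ((k0 + j) ^ 2 + L)) ∂μ := by
        apply integral_mono (hint _)
        · apply integrable_dep μ ((k0 + j) ^ 2 + L)
          intro ρ ρ' h
          simp only
          rw [II_dep t N _ ρ ρ' h, h _ le_rfl]
        · intro ρ
          refine (II_anti t N _ _ hle ρ).trans ?_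
          by_cases hI : ∀ i, N ≤ i → i ≤ (k0 + j) ^ 2 + L → ρ i ≠ t
          · have h3 := hI ((k0 + j) ^ 2 + L) (by omega) le_rfl
            have h4 : ¬ d (ρ ((k0 + j) ^ 2 + L)) ≤ 0 := fun h => h3 (hd0 _ (by omega))
            simp only [phi, if_neg h4, mul_one, le_refl]
          · simp [II, hI]
      have h5 : ∫ ρ, II t N ((k0 + j) ^ 2) ρ * phi c d (0 + L) (ρ ((k0 + j) ^ 2)) ∂μ =
          (∫ ρ, II t N ((k0 + j) ^ 2) ρ ∂μ) * γ := by
        rw [← integral_mul_const]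
        congr 1
        funext ρ
        simp [phi, hdL, γ]
      rw [h5] at h1
      rw [pow_succ]
      exact h2.trans (h1.trans (mul_le_mul_of_nonneg_right ih hγ0))
  have hmeas : ∀ n, MeasurableSet {ρ : ℕ → Q | ∀ i, N ≤ i → i ≤ n → ρ i ≠ t} := by
    intro n
    have : {ρ : ℕ → Q | ∀ i, N ≤ i → i ≤ n → ρ i ≠ t} =
        ⋂ i ∈ Finset.Icc N n, (fun ρ : ℕ → Q => ρ i) ⁻¹' {t}ᶜ := by
      ext ρ
      simp [and_imp]
    rw [this]
    exact Finset.measurableSet_biInter _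
      (fun i _ => (measurable_pi_apply i) (measurableSet_singleton _).compl)
  have hreal : ∀ n, μ.real {ρ : ℕ → Q | ∀ i, N ≤ i → i ≤ n → ρ i ≠ t} = ∫ ρ, II t N n ρ ∂μ := by
    intro n
    rw [← integral_indicator_one (hmeas n)]
    congr 1
    funext ρ
    simp [II, Set.indicator_apply]
  have hzero : μ.real {ρ : ℕ → Q | ¬ ∃ n, N ≤ n ∧ ρ n = t} = 0 := by
    apply le_antisymm _ measureReal_nonneg
    refine ge_of_tendsto' (tendsto_pow_atTop_nhds_zero_of_lt_one hγ0 hγ1) fun j => ?_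
    refine le_trans ?_ (hblock j)
    rw [← hreal]
    refine measureReal_mono ?_ (measure_ne_top μ _)
    intro ρ hρ i hi _ hit
    exact hρ ⟨i, hi, hit⟩
  rw [ae_iff]
  rwa [measureReal_eq_zero_iff] at hzero

end Final

/-- Key lemma (non-strict version): in an MDP whose whole state space is an
end-component with even minimal priority, if some state has expected mean-payoff
value at least `ν`, then some strategy wins the mean-payoff parity objective
`Parity(p) ∩ MeanPayoff^{≥ν}` almost surely from every state. -/
theorem key_lemma_ge [Fintype Q] [Nonempty Q]
    [MeasurableSpace Q] [MeasurableSingletonClass Q]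
    (M : MDP Q) (p : Q → ℕ) (w : Q → Q → ℤ) (ν : ℝ)
    (hEC : M.IsEndComponent Set.univ)
    (hmin : Even (sInf (Set.range p)))
    (hval : ∃ q : Q, ν ≤ ValMP M w q) :
    ∃ σstar : Strategy M, ∀ q : Q, ∃ μ : Measure (ℕ → Q),
      IsTrajMeasure M σstar q μ ∧ μ (ParitySet p ∩ MeanPayoffGe w ν) = 1 := by
  obtain ⟨qv, hqv⟩ := hval
  obtain ⟨g, H, hB⟩ := acoe M hEC w
  have hνg : ν ≤ g := hqv.trans (val_le M hEC w g H hB qv)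
  obtain ⟨t, ht⟩ : ∃ t, p t = sInf (Set.range p) := Nat.sInf_mem (Set.range_nonempty p)
  obtain ⟨d, r, hd0, hrE, hd⟩ := exists_dist M hEC t
  obtain ⟨c, hc0, hc1, hc⟩ := exists_cmin M
  let L := ∑ x, d x
  have hdL : ∀ x, d x ≤ L := fun x =>
    Finset.single_le_sum (f := d) (fun _ _ => Nat.zero_le _) (Finset.mem_univ x)
  have ha : ∀ x, ∃ y, M.E x y ∧ (x ∈ M.Q1 → (w x y : ℝ) + H y = g + H x) := by
    intro x
    by_cases hx : x ∈ M.Q1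
    · obtain ⟨y, hy, hy2⟩ := Finset.exists_mem_eq_sup' (succs_ne M x)
        (fun q' => (w x q' : ℝ) + 1 * H q')
      refine ⟨y, by simpa [succs] using hy, fun _ => ?_⟩
      rw [← hB x]
      unfold Bell
      rw [if_pos hx, hy2, one_mul]
    · obtain ⟨y, hy⟩ := M.E_nonempty x
      exact ⟨y, hy, fun h => absurd h hx⟩
  choose a haE ha using ha
  let σ : Strategy M :=
    { act := fun h x => PMF.pure (if Sch L h.length then r x else a x)
      act_support := by
        intro h x _ y hy
        rw [PMF.support_pure, Set.mem_singleton_iff] at hy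
        rw [hy]
        split_ifs
        · exact hrE x
        · exact haE x }
  refine ⟨σ, fun q => ?_⟩
  obtain ⟨μ, hμ⟩ := exists_traj M σ q
  have hprob := hμ.1
  refine ⟨μ, hμ, ?_⟩
  have hvisit : ∀ᵐ ρ ∂μ, ∀ N, ∃ n, N ≤ n ∧ ρ n = t := by
    refine visit M hμ t d r c hc0 hc1 L hdL hd0 hd ?_
    intro h x hS _
    by_cases hx : x ∈ M.Q1
    · simpa [MDP.step, hx, σ, hS] using hc1
    · simpa [MDP.step, hx] using hc x hx _ (hrE x)
  obtain ⟨K, hK0, hK⟩ := fin_bound2 (fun x y => (w x y : ℝ) + H y - H x - g)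
  obtain ⟨B, hB0, hBH⟩ := fin_bound2 (fun x y => H y - H x)
  let Z : ℕ → Q → Q → ℝ := fun n x y =>
    ((w x y : ℝ) + H y - H x - g) + (if Sch L n then K else 0)
  have hmp : ∀ᵐ ρ ∂μ, ν ≤ MP w ρ := by
    have h1 : ∀ k : ℕ, ∀ᵐ ρ ∂μ, ∀ᶠ n : ℕ in atTop, -(1 / (3 * ((k : ℝ) + 1))) * n ≤ PS Z n ρ := by
      intro k
      refine chernoff M hμ Z (2 * K) ?_ ?_ _ (by positivity)
      · intro n x y
        have := abs_le.1 (hK x y)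
        simp only [Z]
        rw [abs_le]
        split_ifs <;> constructor <;> linarith
      · intro h x
        by_cases hS : Sch L h.length
        · apply Finset.sum_nonneg
          intro y _
          apply mul_nonneg ENNReal.toReal_nonneg
          have := abs_le.1 (hK x y)
          simp only [Z, if_pos hS]
          linarith
        · have e : Z h.length x = fun y => ((w x y : ℝ) + H y) - H x - g := by
            funext y
            simp only [Z, if_neg hS, add_zero]
          rw [e, Ex_split]
          have e2 : Ex M σ h x (fun y => (w x y : ℝ) + H y) = g + H x := by
            by_cases hx : x ∈ M.Q1
            · rw [← ha x hx]
              unfold Ex MDP.step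
              rw [if_pos hx]
              rw [Finset.sum_eq_single (a x)]
              · simp [σ, hS]
              · intro y _ hy
                simp [σ, hS, PMF.pure_apply, hy]
              · simp
            · rw [← hB x]
              unfold Ex MDP.step Bell
              rw [if_neg hx, if_neg hx]
              simp
          rw [e2]
          linarith
    rw [← ae_all_iff] at h1
    filter_upwards [h1] with ρ hρ
    refine hνg.trans (MP_ge w ρ g ?_)
    intro k
    obtain ⟨m, hm⟩ := exists_nat_ge (3 * ((k : ℝ) + 1) * B)
    filter_upwards [hρ k, eventually_ge_atTop m,
      sch_small L K (1 / (3 * ((k : ℝ) + 1))) hK0 (by positivity)] with n hn hnm hcount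
    have e : PS Z n ρ = (EL w ρ n + (H (ρ n) - H (ρ 0)) - n * g) +
        K * ((Finset.range n).filter (fun i => Sch L i)).card := by
      rw [← PS_tel]
      simp only [PS, Z, Finset.sum_add_distrib]
      congr 1
      rw [← Finset.sum_filter, Finset.sum_const, nsmul_eq_mul, mul_comm]
    rw [e] at hn
    have h3 := (abs_le.1 (hBH (ρ 0) (ρ n))).2
    have h4 : (m : ℝ) ≤ n := by exact_mod_cast hnm
    have h5 : B ≤ 1 / (3 * ((k : ℝ) + 1)) * n := by
      rw [div_mul_eq_mul_div, one_mul, le_div_iff₀ (by positivity)]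
      linarith
    have h6 : 1 / ((k : ℝ) + 1) = 1 / (3 * ((k : ℝ) + 1)) + 1 / (3 * ((k : ℝ) + 1)) +
        1 / (3 * ((k : ℝ) + 1)) := by
      field_simp; norm_num
    rw [h6]
    linarith
  have hall : ∀ᵐ ρ ∂μ, ρ ∈ ParitySet p ∩ MeanPayoffGe w ν := by
    filter_upwards [hvisit, hmp] with ρ h1 h2
    refine ⟨?_, h2⟩
    have e : sInf (p '' infSet ρ) = sInf (Set.range p) := by
      apply le_antisymm
      · rw [← ht]
        exact Nat.sInf_le ⟨t, h1, rfl⟩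
      · obtain ⟨y, _, hy⟩ := Nat.sInf_mem (s := p '' infSet ρ) ⟨_, t, h1, rfl⟩
        rw [← hy]
        exact Nat.sInf_le ⟨y, rfl⟩
    change Even (sInf (p '' infSet ρ))
    rw [e]
    exact hmin
  rw [← measure_univ (μ := μ)]
  exact measure_congr (eventuallyEq_univ.2 hall)

end MPP
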